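/- Let T be the binary tree and let V_α be the one-weight summation operator with weight satisfying α(t) ≥ c |t|^{-γ/q} for all t with |t| ≥ 1, for some γ > 1 and c > 0. Then there is a constant c' > 0 such that for all n ≥ 2: if γ > q, then e_n(V_α : ℓ_1(T) → ℓ_q(T)) ≥ c' n^{-1/q'} (log n)^{1 − γ/q}, and if γ ≤ q, then e_n(V_α) ≥ c' n^{-(γ−1)/q}, where 1/q' = 1 − 1/q. -/

import Mathlib

open scoped ENNReal NNReal
open MeasureTheory

noncomputable section

/-- A rooted tree structure on a partially ordered type with bottom element (the root):
the set of ancestors of any node is finite and totally ordered, and every node has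
finitely many offspring (covering elements). -/
def IsTree (T : Type) [PartialOrder T] [OrderBot T] : Prop :=
  (∀ s : T, (Set.Iic s).Finite) ∧
  (∀ s a b : T, a ≤ s → b ≤ s → a ≤ b ∨ b ≤ a) ∧
  (∀ t : T, {s : T | t ⋖ s}.Finite)

/-- The binary tree: a rooted tree in which every node has exactly two offspring. -/
def IsBinaryTree (T : Type) [PartialOrder T] [OrderBot T] : Prop :=
  IsTree T ∧ ∀ t : T, Nat.card {s : T | t ⋖ s} = 2

/-- `glb` assigns to any two nodes their greatest common ancestor. -/
def IsGCA {T : Type} [PartialOrder T] (glb : T → T → T) : Prop :=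
  ∀ t s : T, glb t s ≤ t ∧ glb t s ≤ s ∧ ∀ u : T, u ≤ t → u ≤ s → u ≤ glb t s

/-- The generation `|t|` of a node: the number of its strict ancestors. -/
def gen {T : Type} [PartialOrder T] (t : T) : ℕ := Nat.card (Set.Iio t)

/-- The distance `max_{t ≺ v ⪯ s} (∑_{t ≺ r ⪯ v} α(r)^q)^{1/q} σ(v)` along a branch. -/
def dOrd {T : Type} [PartialOrder T] (q : ℝ) (α σ : T → ℝ) (t s : T) : ℝ :=
  sSup ((fun v => (∑ᶠ r ∈ Set.Ioc t v, α r ^ q) ^ (1 / q) * σ v) '' Set.Ioc t s)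

/- The tree metric `d`, extended by symmetry and via greatest common ancestors. -/
open Classical in
def treeDist {T : Type} [PartialOrder T] (q : ℝ) (α σ : T → ℝ)
    (glb : T → T → T) (t s : T) : ℝ :=
  if t ≤ s then dOrd q α σ t s
  else if s ≤ t then dOrd q α σ s t
  else dOrd q α σ (glb t s) t + dOrd q α σ (glb t s) s

/-- `N(T,d,ε)`: minimal number of open `ε`-balls needed to cover `T` (`∞` if none). -/
def coveringNumber {T : Type} (d : T → T → ℝ) (ε : ℝ) : ℝ≥0∞ :=
  ⨅ S ∈ {S : Finset T | ∀ t : T, ∃ s ∈ S, d s t < ε}, (S.card : ℝ≥0∞)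

/-- `Ñ(T,d,ε)`: minimal cardinality of an order `ε`-net of `T`. -/
def orderCoveringNumber {T : Type} [PartialOrder T] (d : T → T → ℝ) (ε : ℝ) : ℝ≥0∞ :=
  ⨅ S ∈ {S : Finset T | ∀ t : T, ∃ s ∈ S, s ≤ t ∧ d s t < ε}, (S.card : ℝ≥0∞)

/-- Minimal number of open `ε`-balls of a normed space needed to cover the set `A`. -/
def setCoveringNumber {Y : Type} [NormedAddCommGroup Y] (A : Set Y) (ε : ℝ) : ℝ≥0∞ :=
  ⨅ F ∈ {F : Finset Y | ∀ a ∈ A, ∃ y ∈ F, ‖a - y‖ < ε}, (F.card : ℝ≥0∞)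

/-- The dyadic entropy numbers `e_n(V)` of an operator `V`. -/
def entropyNumber {X Y : Type} [NormedAddCommGroup X] [NormedSpace ℝ X]
    [NormedAddCommGroup Y] [NormedSpace ℝ Y] (n : ℕ) (V : X →L[ℝ] Y) : ℝ :=
  sInf {ε : ℝ | 0 < ε ∧ ∃ F : Finset Y, F.card ≤ 2 ^ (n - 1) ∧
    ∀ x : X, ‖x‖ ≤ 1 → ∃ y ∈ F, ‖V x - y‖ < ε}

/-- The space `ℓ₁(T)`. -/
abbrev ellOne (T : Type) := lp (fun _ : T => ℝ) 1

/-- The space `ℓ_q(T)`. -/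
abbrev ellQ (T : Type) (q : ℝ) := lp (fun _ : T => ℝ) (ENNReal.ofReal q)

section BinaryTree

variable {T : Type} [PartialOrder T] [OrderBot T]

/-- The ancestors of an offspring of `t` are `t` and the ancestors of `t`. -/
lemma IsTree.Iio_eq_Iic (hT : IsTree T) {t s : T} (h : t ⋖ s) : Set.Iio s = Set.Iic t := by
  ext a
  refine ⟨fun ha => ?_, fun ha => lt_of_le_of_lt ha h.lt⟩
  rcases hT.2.1 s a t (le_of_lt ha) h.le with h1 | h1
  · exact h1
  · rcases h1.eq_or_lt with h2 | h2
    · exact h2.ge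
    · exact absurd ha (h.2 h2)

lemma IsTree.gen_covBy (hT : IsTree T) {t s : T} (h : t ⋖ s) : gen s = gen t + 1 := by
  have hfin : (Set.Iio t).Finite := (hT.1 t).subset Set.Iio_subset_Iic_self
  unfold gen
  rw [hT.Iio_eq_Iic h, ← Set.Iio_insert, Nat.card_coe_set_eq, Nat.card_coe_set_eq,
    Set.ncard_insert_of_notMem (by simp) hfin]

lemma gen_bot : gen (⊥ : T) = 0 := by simp [gen]

lemma IsTree.gen_lt_gen (hT : IsTree T) {t s : T} (h : t < s) : gen t < gen s := by
  have hfin : (Set.Iio s).Finite := (hT.1 s).subset Set.Iio_subset_Iic_self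
  unfold gen
  rw [Nat.card_coe_set_eq, Nat.card_coe_set_eq]
  exact Set.ncard_lt_ncard (Set.Iio_ssubset_Iio h) hfin

/-- Two ancestors of a node of the same generation coincide. -/
lemma IsTree.eq_of_le_of_gen_eq (hT : IsTree T) {a b s : T} (ha : a ≤ s) (hb : b ≤ s)
    (h : gen a = gen b) : a = b := by
  rcases hT.2.1 s a b ha hb with h1 | h1 <;> rcases h1.eq_or_lt with h2 | h2
  · exact h2
  · exact absurd h (hT.gen_lt_gen h2).ne
  · exact h2.symm
  · exact absurd h (hT.gen_lt_gen h2).ne'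

lemma IsBinaryTree.exists_child (hT : IsBinaryTree T) :
    ∃ child : T → Bool → T, (∀ t b, t ⋖ child t b) ∧ ∀ t, Function.Injective (child t) := by
  have h (t : T) : ∃ f : Bool → T, (∀ b, t ⋖ f b) ∧ Function.Injective f := by
    have : Finite {s : T | t ⋖ s} := hT.1.2.2 t
    have e : {s : T | t ⋖ s} ≃ Bool :=
      (Finite.equivFinOfCardEq (hT.2 t)).trans finTwoEquiv
    exact ⟨fun b => (e.symm b).1, fun b => (e.symm b).2,
      Subtype.val_injective.comp e.symm.injective⟩
  choose f hf using h
  exact ⟨f, fun t => (hf t).1, fun t => (hf t).2⟩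

/-- Any finite type with at most `2 ^ m` elements embeds into the `m`-th generation. -/
lemma IsBinaryTree.exists_injective_gen (hT : IsBinaryTree T) {ι : Type*} [Fintype ι] {m : ℕ}
    (hι : Fintype.card ι ≤ 2 ^ m) :
    ∃ φ : ι → T, Function.Injective φ ∧ ∀ i, gen (φ i) = m := by
  obtain ⟨child, hcov, hinj⟩ := hT.exists_child
  let node : List Bool → T := fun l => l.foldr (fun b t => child t b) ⊥
  have hgen (l : List Bool) : gen (node l) = l.length := by
    induction l with
    | nil => exact gen_bot
    | cons b l ih => rw [List.length_cons, ← ih]; exact hT.1.gen_covBy (hcov _ _)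
  have hnode : Function.Injective node := by
    intro l
    induction l with
    | nil =>
      intro l' h
      have h' := congrArg gen h
      rw [hgen, hgen] at h'
      exact (List.length_eq_zero_iff.1 h'.symm).symm
    | cons b l ih =>
      intro l' h
      have h' := congrArg gen h
      rw [hgen, hgen] at h'
      cases l' with
      | nil => simp at h'
      | cons b' l' =>
        have h2 : child (node l) b = child (node l') b' := h
        have h3 : node l = node l' := by
          refine hT.1.eq_of_le_of_gen_eq (hcov (node l) b).le (h2 ▸ (hcov (node l') b').le) ?_
          rw [hgen, hgen]
          simpa using h'
        rw [← h3] at h2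
        rw [hinj _ h2, ih h3]
  have hcard : Fintype.card ι ≤ Fintype.card (List.Vector Bool m) := by
    simpa [card_vector] using hι
  obtain ⟨e⟩ := Function.Embedding.nonempty_of_card_le hcard
  exact ⟨fun i => node (e i).1,
    hnode.comp (Subtype.val_injective.comp e.injective),
    fun i => by rw [hgen]; exact (e i).2⟩

/-- From every node starts an infinite chain of descendants. -/
lemma IsBinaryTree.exists_chain (hT : IsBinaryTree T) (u : T) :
    ∃ p : ℕ → T, p 0 = u ∧ Monotone p ∧ ∀ j, gen (p j) = gen u + j := by
  obtain ⟨child, hcov, -⟩ := hT.exists_child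
  have hstep (j : ℕ) : (fun t => child t true)^[j] u ⋖ (fun t => child t true)^[j + 1] u := by
    rw [Function.iterate_succ_apply']
    exact hcov _ _
  refine ⟨fun j => (fun t => child t true)^[j] u, rfl,
    monotone_nat_of_le_succ fun j => (hstep j).le, fun j => ?_⟩
  induction j with
  | zero => rfl
  | succ j ih => rw [hT.1.gen_covBy (hstep j), ih, add_assoc]

end BinaryTree

/-- A separated family in the image of the unit ball bounds the entropy numbers from below. -/
lemma le_entropyNumber_of_separated {X Y : Type} [NormedAddCommGroup X] [NormedSpace ℝ X]
    [NormedAddCommGroup Y] [NormedSpace ℝ Y] (V : X →L[ℝ] Y) {n : ℕ} {C : Type*} [Fintype C]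
    (hC : 2 ^ (n - 1) < Fintype.card C) (x : C → X) (hx : ∀ a, ‖x a‖ ≤ 1) {δ : ℝ}
    (hδ : ∀ a b, a ≠ b → δ ≤ ‖V (x a) - V (x b)‖) : δ / 2 ≤ entropyNumber n V := by
  refine le_csInf ⟨‖V‖ + 1, by positivity, {0}, by simpa using Nat.one_le_two_pow, ?_⟩ ?_
  · intro z hz
    refine ⟨0, by simp, ?_⟩
    rw [sub_zero]
    have := V.le_opNorm_of_le hz
    linarith
  · rintro ε ⟨-, F, hF, hcov⟩
    choose y hyF hy using fun a => hcov (x a) (hx a)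
    obtain ⟨a, -, b, -, hab, he⟩ := Finset.exists_ne_map_eq_of_card_lt_of_maps_to
      (s := Finset.univ) (t := F) (hF.trans_lt hC) (f := y) (fun a _ => hyF a)
    have h1 := hδ a b hab
    have h2 := hy a
    have h3 := hy b
    rw [← he] at h3
    have h4 : ‖V (x a) - V (x b)‖ ≤ ‖V (x a) - y a‖ + ‖V (x b) - y a‖ := by
      rw [show V (x a) - V (x b) = (V (x a) - y a) - (V (x b) - y a) by abel]
      exact norm_sub_le _ _
    linarith

/-- Polynomials of degree less than `d` form a code: distinct ones agree in fewer than `d`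
points. -/
lemma exists_evaluation_code (F : Type*) [Field F] [Fintype F] [DecidableEq F] (d : ℕ) :
    ∃ f : (Fin d → F) → F → F, ∀ a b, a ≠ b →
      Fintype.card F ≤ (Finset.univ.filter fun x => f a x ≠ f b x).card + d := by
  let P : (Fin d → F) → Polynomial F := fun a => ((Polynomial.degreeLTEquiv F d).symm a).1
  refine ⟨fun a x => (P a).eval x, fun a b hab => ?_⟩
  have hne : P a - P b ≠ 0 := by
    intro h
    exact hab ((Polynomial.degreeLTEquiv F d).symm.injective (Subtype.ext (sub_eq_zero.1 h)))
  have hdeg : (P a - P b).degree < d := Polynomial.mem_degreeLT.1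
    (Submodule.sub_mem _ ((Polynomial.degreeLTEquiv F d).symm a).2
      ((Polynomial.degreeLTEquiv F d).symm b).2)
  have hagree : (Finset.univ.filter fun x => ¬ (P a).eval x ≠ (P b).eval x).card ≤ d := by
    have hsub : (Finset.univ.filter fun x => ¬ (P a).eval x ≠ (P b).eval x) ⊆
        (P a - P b).roots.toFinset := by
      intro x hx
      simp only [ne_eq, not_not, Finset.mem_filter, Finset.mem_univ, true_and] at hx
      simp [hne, hx]
    have h1 := Finset.card_le_card hsub
    have h2 := (P a - P b).roots.toFinset_card_le
    have h3 := (P a - P b).card_roots'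
    have h4 := (Polynomial.natDegree_lt_iff_degree_lt hne).2 hdeg
    omega
  have := Finset.card_filter_add_card_filter_not (s := (Finset.univ : Finset F))
    (fun x => (P a).eval x ≠ (P b).eval x)
  rw [Finset.card_univ] at this
  rw [← this]
  exact Nat.add_le_add_left hagree _

section SummationOperator

variable {T : Type} [PartialOrder T]

open Classical in
/-- The summation operator maps the unit vector at `s` to the weight restricted to the branch
ending in `s`. -/
lemma summation_single {q : ℝ} [Fact (1 ≤ ENNReal.ofReal q)] {α : T → ℝ}
    {V : ellOne T →L[ℝ] ellQ T q}
    (hV : ∀ (x : ellOne T) (t : T), (V x : ∀ _ : T, ℝ) t =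
      α t * ∑' s : {s : T // t ≤ s}, (x : ∀ _ : T, ℝ) s.1) (s t : T) :
    (V (lp.single 1 s (1 : ℝ)) : ∀ _ : T, ℝ) t = if t ≤ s then α t else 0 := by
  rw [hV]
  split_ifs with h
  · rw [tsum_eq_single ⟨s, h⟩]
    · simp
    · intro b hb
      have : b.1 ≠ s := fun h' => hb (Subtype.ext h')
      simp [this]
  · have hz (b : {b : T // t ≤ b}) : (lp.single 1 s (1 : ℝ) : ∀ _ : T, ℝ) b.1 = 0 := by
      have : b.1 ≠ s := fun h' => h (h' ▸ b.2)
      simp [this]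
    rw [tsum_congr hz, tsum_zero, mul_zero]

open Classical in
/-- Averages of unit vectors over a code whose distinct words differ in at least `D` places are
well separated by the summation operator. -/
lemma le_entropyNumber_of_code [OrderBot T] (hT : IsBinaryTree T) {q : ℝ} (hq : 1 < q)
    [Fact (1 ≤ ENNReal.ofReal q)] {α : T → ℝ} {V : ellOne T →L[ℝ] ellQ T q}
    (hV : ∀ (x : ellOne T) (t : T), (V x : ∀ _ : T, ℝ) t =
      α t * ∑' s : {s : T // t ≤ s}, (x : ∀ _ : T, ℝ) s.1)
    {c γ : ℝ} (hc : 0 < c) (hγ : 0 < γ)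
    (hw : ∀ t : T, 1 ≤ gen t → c * (gen t : ℝ) ^ (-(γ / q)) ≤ α t)
    {ι κ C : Type*} [Fintype ι] [Nonempty ι] [Fintype κ] [Fintype C] {m n D : ℕ} (hm : 1 ≤ m)
    (hcard : Fintype.card (ι × κ) ≤ 2 ^ m) (hC : 2 ^ (n - 1) < Fintype.card C) (f : C → ι → κ)
    (hf : ∀ a b, a ≠ b → D ≤ (Finset.univ.filter fun i => f a i ≠ f b i).card)
    {δ : ℝ} (hδ : δ ^ q ≤ D * m * (c * (2 * m : ℝ) ^ (-(γ / q)) / Fintype.card ι) ^ q) :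
    δ / 2 ≤ entropyNumber n V := by
  have hq0 : 0 < q := by linarith
  have hqr : (ENNReal.ofReal q).toReal = q := ENNReal.toReal_ofReal hq0.le
  obtain ⟨φ, hφ, hφgen⟩ := hT.exists_injective_gen hcard
  choose p hp0 hpmono hpgen using hT.exists_chain
  have hple (u : T) (j : ℕ) : u ≤ p u j := by
    conv_lhs => rw [← hp0 u]
    exact hpmono u (Nat.zero_le j)
  set N : ℝ := (Fintype.card ι : ℝ) with hN
  have hN0 : 0 < N := by rw [hN]; exact_mod_cast Fintype.card_pos
  have hroot {w w' : ι × κ} {t : T} (h : φ w ≤ t) (h' : φ w' ≤ t) : w = w' :=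
    hφ (hT.1.eq_of_le_of_gen_eq h h' (by rw [hφgen, hφgen]))
  let x : C → ellOne T := fun a =>
    ∑ i, N⁻¹ • (lp.single 1 (p (φ (i, f a i)) m) (1 : ℝ) : ellOne T)
  have hVx (a : C) (t : T) : (V (x a) : ∀ _ : T, ℝ) t =
      ∑ i, N⁻¹ * if t ≤ p (φ (i, f a i)) m then α t else 0 := by
    simp only [x, map_sum, map_smul, lp.coeFn_sum, Finset.sum_apply, lp.coeFn_smul,
      Pi.smul_apply, smul_eq_mul, summation_single hV]
  have hx (a : C) : ‖x a‖ ≤ 1 := by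
    refine (norm_sum_le _ _).trans ?_
    simp only [norm_smul, lp.norm_single one_pos]
    simp [abs_of_pos hN0, ← hN, hN0.ne']
  refine le_entropyNumber_of_separated V hC x hx fun a b hab => ?_
  set A := Finset.univ.filter fun i => f a i ≠ f b i with hA
  have hval (i : ι) (hi : i ∈ A) (j : ℕ) (hj : j < m) :
      ((V (x a) - V (x b) : ellQ T q) : ∀ _ : T, ℝ) (p (φ (i, f a i)) j) =
        α (p (φ (i, f a i)) j) / N := by
    have ha : (V (x a) : ∀ _ : T, ℝ) (p (φ (i, f a i)) j) = α (p (φ (i, f a i)) j) / N := by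
      rw [hVx, Finset.sum_eq_single i]
      · rw [if_pos (hpmono _ hj.le)]; ring
      · intro i' _ hi'
        rw [if_neg, mul_zero]
        intro hle
        have := hroot ((hple _ j).trans hle) (hple _ m)
        exact hi' (congrArg Prod.fst this).symm
      · simp
    have hb : (V (x b) : ∀ _ : T, ℝ) (p (φ (i, f a i)) j) = 0 := by
      rw [hVx]
      refine Finset.sum_eq_zero fun i' _ => ?_
      rw [if_neg, mul_zero]
      intro hle
      have h := hroot ((hple _ j).trans hle) (hple _ m)
      obtain rfl : i = i' := congrArg Prod.fst h
      exact (Finset.mem_filter.1 hi).2 (congrArg Prod.snd h)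
    rw [lp.coeFn_sub, Pi.sub_apply, ha, hb, sub_zero]
  have hinj : Set.InjOn (fun w : ι × ℕ => p (φ (w.1, f a w.1)) w.2)
      (A ×ˢ Finset.range m : Finset (ι × ℕ)) := by
    rintro ⟨i, j⟩ - ⟨i', j'⟩ - h
    simp only at h
    have h1 := congrArg gen h
    rw [hpgen, hpgen, hφgen, hφgen] at h1
    have h2 := hroot (hple _ j) (h ▸ hple (φ (i', f a i')) j')
    exact Prod.ext (Prod.ext_iff.1 h2).1 (by simpa using h1)
  have hterm (i : ι) (hi : i ∈ A) (j : ℕ) (hj : j < m) :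
      (c * (2 * m : ℝ) ^ (-(γ / q)) / N) ^ q ≤
        ‖((V (x a) - V (x b) : ellQ T q) : ∀ _ : T, ℝ) (p (φ (i, f a i)) j)‖ ^ q := by
    rw [hval i hi j hj]
    have hg : gen (p (φ (i, f a i)) j) = m + j := by rw [hpgen, hφgen]
    have hw' := hw (p (φ (i, f a i)) j) (by omega)
    rw [hg] at hw'
    have hmono : (2 * m : ℝ) ^ (-(γ / q)) ≤ ((m + j : ℕ) : ℝ) ^ (-(γ / q)) := by
      refine Real.rpow_le_rpow_of_nonpos (by exact_mod_cast (by omega : 0 < m + j)) ?_ ?_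
      · exact_mod_cast (by omega : m + j ≤ 2 * m)
      · have := div_pos hγ hq0
        linarith
    refine Real.rpow_le_rpow (by positivity) (le_trans ?_ (Real.le_norm_self _)) hq0.le
    gcongr
    exact (mul_le_mul_of_nonneg_left hmono hc.le).trans hw'
  have hsum := lp.sum_rpow_le_norm_rpow (by rwa [hqr]) (V (x a) - V (x b))
    ((A ×ˢ Finset.range m).image fun w : ι × ℕ => p (φ (w.1, f a w.1)) w.2)
  rw [hqr, Finset.sum_image hinj, Finset.sum_product] at hsum
  have hlow : (D : ℝ) * m * (c * (2 * m : ℝ) ^ (-(γ / q)) / N) ^ q ≤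
      ‖V (x a) - V (x b)‖ ^ q := by
    refine le_trans ?_ hsum
    calc (D : ℝ) * m * (c * (2 * m : ℝ) ^ (-(γ / q)) / N) ^ q
        ≤ A.card * m * (c * (2 * m : ℝ) ^ (-(γ / q)) / N) ^ q := by
          gcongr
          exact hf a b hab
      _ = ∑ i ∈ A, ∑ j ∈ Finset.range m, (c * (2 * m : ℝ) ^ (-(γ / q)) / N) ^ q := by
          simp [mul_assoc]
      _ ≤ _ := Finset.sum_le_sum fun i hi => Finset.sum_le_sum fun j hj =>
          hterm i hi j (Finset.mem_range.1 hj)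
  by_contra! hlt
  exact (Real.rpow_lt_rpow (norm_nonneg _) hlt hq0).not_ge (hδ.trans hlow)

/-- The entropy bound obtained from separated unit vectors. -/
lemma le_entropyNumber_of_unit_vectors [OrderBot T] (hT : IsBinaryTree T) {q : ℝ} (hq : 1 < q)
    [Fact (1 ≤ ENNReal.ofReal q)] {α : T → ℝ} {V : ellOne T →L[ℝ] ellQ T q}
    (hV : ∀ (x : ellOne T) (t : T), (V x : ∀ _ : T, ℝ) t =
      α t * ∑' s : {s : T // t ≤ s}, (x : ∀ _ : T, ℝ) s.1)
    {c γ : ℝ} (hc : 0 < c) (hγ : 0 < γ)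
    (hw : ∀ t : T, 1 ≤ gen t → c * (gen t : ℝ) ^ (-(γ / q)) ≤ α t) {n : ℕ} (hn : 1 ≤ n) :
    c * 2 ^ (-(γ / q)) * (n : ℝ) ^ (-((γ - 1) / q)) / 2 ≤ entropyNumber n V := by
  have hq0 : 0 < q := by linarith
  have hn0 : (0 : ℝ) < n := by exact_mod_cast hn
  refine le_entropyNumber_of_code (ι := Unit) (κ := Fin (2 ^ n)) (C := Fin (2 ^ n)) (m := n)
    (D := 1) hT hq hV hc hγ hw hn (by simp) ?_ (fun a _ => a) ?_ ?_
  · rw [Fintype.card_fin]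
    exact Nat.pow_lt_pow_right (by norm_num) (by omega)
  · intro a b hab
    simp [hab]
  · have h1 : (n : ℝ) = ((n : ℝ) ^ (1 / q)) ^ q := by
      rw [← Real.rpow_mul hn0.le, one_div_mul_cancel hq0.ne', Real.rpow_one]
    have h2 : c * 2 ^ (-(γ / q)) * (n : ℝ) ^ (-((γ - 1) / q)) =
        (n : ℝ) ^ (1 / q) * (c * (2 * n : ℝ) ^ (-(γ / q))) := by
      rw [Real.mul_rpow (by norm_num) hn0.le,
        show -((γ - 1) / q) = 1 / q + -(γ / q) by ring, Real.rpow_add hn0]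
      ring
    rw [h2, Real.mul_rpow (by positivity) (by positivity), ← h1]
    simp

/-- The entropy bound obtained from averages over a polynomial code. -/
lemma le_entropyNumber_of_evaluation_code [OrderBot T] (hT : IsBinaryTree T) {q : ℝ} (hq : 1 < q)
    [Fact (1 ≤ ENNReal.ofReal q)] {α : T → ℝ} {V : ellOne T →L[ℝ] ellQ T q}
    (hV : ∀ (x : ellOne T) (t : T), (V x : ∀ _ : T, ℝ) t =
      α t * ∑' s : {s : T // t ≤ s}, (x : ∀ _ : T, ℝ) s.1)
    {c γ : ℝ} (hc : 0 < c) (hγ : 0 < γ)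
    (hw : ∀ t : T, 1 ≤ gen t → c * (gen t : ℝ) ^ (-(γ / q)) ≤ α t) {n k : ℕ} (hn : 1 ≤ n)
    (hk : 1 ≤ k) (hkn : 2 * n ≤ k * 2 ^ k) :
    c * 4 ^ (-(γ / q)) * ((2 : ℝ) ^ k) ^ (1 / q - 1) * (k : ℝ) ^ (1 / q - γ / q) / 2 ≤
      entropyNumber n V := by
  classical
  have hq0 : 0 < q := by linarith
  have hk0 : (0 : ℝ) < k := by exact_mod_cast hk
  have : Fintype (GaloisField 2 k) := Fintype.ofFinite _
  have hF : Fintype.card (GaloisField 2 k) = 2 ^ k := by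
    rw [← Nat.card_eq_fintype_card, GaloisField.card 2 k (by omega)]
  have hhalf : 2 ^ k = 2 * 2 ^ (k - 1) := by
    rw [← pow_succ', Nat.sub_add_cancel hk]
  obtain ⟨f, hf⟩ := exists_evaluation_code (GaloisField 2 k) (2 ^ (k - 1))
  refine le_entropyNumber_of_code (m := 2 * k) (D := 2 ^ (k - 1)) hT hq hV hc hγ hw (by omega)
    ?_ ?_ f ?_ ?_
  · rw [Fintype.card_prod, hF, ← pow_add, two_mul]
  · rw [Fintype.card_fun, Fintype.card_fin, hF, ← pow_mul]
    refine Nat.pow_lt_pow_right (by norm_num) ?_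
    rw [hhalf, mul_left_comm] at hkn
    omega
  · intro a b hab
    have := hf a b hab
    rw [hF] at this
    omega
  · set N : ℝ := (2 : ℝ) ^ k with hN
    have hN0 : 0 < N := by positivity
    have hD : (((2 : ℕ) ^ (k - 1) : ℕ) : ℝ) * ((2 * k : ℕ) : ℝ) = N * k := by
      have : (N : ℝ) = 2 * 2 ^ (k - 1) := by rw [hN]; exact_mod_cast hhalf
      rw [this]
      push_cast
      ring
    have hroot {y : ℝ} (hy : 0 ≤ y) : (y ^ (1 / q)) ^ q = y := by
      rw [← Real.rpow_mul hy, one_div_mul_cancel hq0.ne', Real.rpow_one]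
    have h2 : c * 4 ^ (-(γ / q)) * N ^ (1 / q - 1) * (k : ℝ) ^ (1 / q - γ / q) =
        (N * k) ^ (1 / q) * (c * (2 * (2 * k) : ℝ) ^ (-(γ / q)) / N) := by
      rw [show (2 * (2 * k) : ℝ) = 4 * k by ring, Real.mul_rpow (x := 4) (by norm_num) hk0.le,
        Real.mul_rpow hN0.le hk0.le, sub_eq_add_neg (1 / q) (γ / q), Real.rpow_add hk0,
        Real.rpow_sub hN0, Real.rpow_one]
      ring
    rw [hD, hF, h2, Real.mul_rpow (by positivity) (by positivity), hroot (by positivity)]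
    simp [hN]

end SummationOperator

/-- A dyadic scale comparable with `n`, whose exponent is at most logarithmic in `n`. -/
lemma exists_dyadic_scale {n : ℕ} (hn : 2 ≤ n) :
    ∃ k : ℕ, 1 ≤ k ∧ 2 * n ≤ k * 2 ^ k ∧ k * 2 ^ k ≤ 8 * n ∧
      (k : ℝ) ≤ 4 / Real.log 2 * Real.log n := by
  have hex : ∃ k : ℕ, 2 * n ≤ k * 2 ^ k :=
    ⟨2 * n, Nat.le_mul_of_pos_right _ (by positivity)⟩
  classical
  obtain ⟨k, hk, hmin⟩ : ∃ k : ℕ, 2 * n ≤ k * 2 ^ k ∧ ∀ j < k, j * 2 ^ j < 2 * n :=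
    ⟨Nat.find hex, Nat.find_spec hex, fun j hj => not_le.1 (Nat.find_min hex hj)⟩
  obtain ⟨j, rfl⟩ : ∃ j, k = j + 2 := by
    refine ⟨k - 2, (Nat.sub_add_cancel ?_).symm⟩
    by_contra! h
    interval_cases k <;> omega
  have hj := hmin (j + 1) (by omega)
  have hpow : 2 ^ (j + 1) < 2 * n := by nlinarith [Nat.zero_le (j * 2 ^ (j + 1))]
  refine ⟨j + 2, by omega, hk, ?_, ?_⟩
  · rw [pow_succ]
    nlinarith [Nat.zero_le (j * 2 ^ (j + 1))]
  · have hl2 : 0 < Real.log 2 := Real.log_pos (by norm_num)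
    have hn2 : (2 : ℝ) ≤ n := by exact_mod_cast hn
    have hln : Real.log 2 ≤ Real.log n := Real.log_le_log (by norm_num) hn2
    have h1 : (2 : ℝ) ^ (j + 1) ≤ 2 * n := by exact_mod_cast hpow.le
    have h2 := Real.log_le_log (by positivity) h1
    rw [Real.log_pow, Real.log_mul (by norm_num) (by positivity)] at h2
    push_cast at h2 ⊢
    rw [div_mul_eq_mul_div, le_div_iff₀ hl2]
    nlinarith [mul_nonneg (Nat.cast_nonneg (α := ℝ) j) hl2.le]

theorem stmt19 {T : Type} [Countable T] [PartialOrder T] [OrderBot T]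
    (hbin : IsBinaryTree T) (q : ℝ) (hq : 1 < q)
    (α : T → ℝ) (hα : ∀ t, 0 < α t)
    (K : ℝ) (hK : ∀ s : T, (∑ᶠ r ∈ Set.Iic s, α r ^ q) ^ (1 / q) ≤ K)
    [Fact (1 ≤ ENNReal.ofReal q)]
    (V : ellOne T →L[ℝ] ellQ T q)
    (hV : ∀ (x : ellOne T) (t : T), (V x : ∀ _ : T, ℝ) t =
      α t * ∑' s : {s : T // t ≤ s}, (x : ∀ _ : T, ℝ) s.1)
    (c γ : ℝ) (hc : 0 < c) (hγ : 1 < γ)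
    (hw : ∀ t : T, 1 ≤ gen t → c * (gen t : ℝ) ^ (-(γ / q)) ≤ α t)
    (q' : ℝ) (hq' : 1 / q' = 1 - 1 / q) :
    ∃ c' > 0, ∀ n : ℕ, 2 ≤ n →
      (q < γ →
        c' * (n : ℝ) ^ (-(1 / q')) * Real.log n ^ (1 - γ / q) ≤ entropyNumber n V) ∧
      (γ ≤ q → c' * (n : ℝ) ^ (-((γ - 1) / q)) ≤ entropyNumber n V) := by
  have hq0 : 0 < q := by linarith
  have hγ0 : 0 < γ := by linarith
  rcases lt_or_ge q γ with hqγ | hqγ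
  · have hl2 : 0 < Real.log 2 := Real.log_pos (by norm_num)
    refine ⟨c * 4 ^ (-(γ / q)) * 8 ^ (1 / q - 1) * (4 / Real.log 2) ^ (1 - γ / q) / 2,
      by positivity, fun n hn => ⟨fun _ => ?_, fun h => absurd h hqγ.not_ge⟩⟩
    obtain ⟨k, hk, hkn, hk8, hklog⟩ := exists_dyadic_scale hn
    refine le_trans ?_ (le_entropyNumber_of_evaluation_code hbin hq hV hc hγ0 hw (by omega) hk hkn)
    have hn0 : (0 : ℝ) < n := by exact_mod_cast (by omega : 0 < n)
    have hk0 : (0 : ℝ) < k := by exact_mod_cast hk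
    have hlog : 0 < Real.log n := Real.log_pos (by exact_mod_cast hn)
    have hexp : 1 / q - 1 ≤ 0 := by
      rw [sub_nonpos, div_le_one hq0]
      exact hq.le
    have hexp' : 1 - γ / q ≤ 0 := by
      rw [sub_nonpos, one_le_div hq0]
      exact hqγ.le
    have h1 : 8 ^ (1 / q - 1) * (n : ℝ) ^ (1 / q - 1) ≤
        ((2 : ℝ) ^ k) ^ (1 / q - 1) * (k : ℝ) ^ (1 / q - 1) := by
      rw [← Real.mul_rpow (by norm_num) hn0.le, ← Real.mul_rpow (by positivity) hk0.le]
      refine Real.rpow_le_rpow_of_nonpos (by positivity) ?_ hexp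
      rw [mul_comm]
      exact_mod_cast hk8
    have h2 : (4 / Real.log 2) ^ (1 - γ / q) * Real.log n ^ (1 - γ / q) ≤
        (k : ℝ) ^ (1 - γ / q) := by
      rw [← Real.mul_rpow (by positivity) hlog.le]
      exact Real.rpow_le_rpow_of_nonpos hk0 hklog hexp'
    rw [hq', neg_sub, show 1 / q - γ / q = (1 / q - 1) + (1 - γ / q) by ring,
      Real.rpow_add hk0]
    calc c * 4 ^ (-(γ / q)) * 8 ^ (1 / q - 1) * (4 / Real.log 2) ^ (1 - γ / q) / 2 *
          (n : ℝ) ^ (1 / q - 1) * Real.log n ^ (1 - γ / q)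
        = c * 4 ^ (-(γ / q)) / 2 * ((8 ^ (1 / q - 1) * (n : ℝ) ^ (1 / q - 1)) *
          ((4 / Real.log 2) ^ (1 - γ / q) * Real.log n ^ (1 - γ / q))) := by ring
      _ ≤ c * 4 ^ (-(γ / q)) / 2 * ((((2 : ℝ) ^ k) ^ (1 / q - 1) * (k : ℝ) ^ (1 / q - 1)) *
          (k : ℝ) ^ (1 - γ / q)) := by gcongr
      _ = _ := by ring
  · refine ⟨c * 2 ^ (-(γ / q)) / 2, by positivity,
      fun n hn => ⟨fun h => absurd h hqγ.not_gt, fun _ => ?_⟩⟩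
    refine le_of_eq_of_le ?_
      (le_entropyNumber_of_unit_vectors hbin hq hV hc hγ0 hw (by omega : 1 ≤ n))
    ring
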